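/- arXiv:2402.14845 — 6 statements merged into one kernel-verified Lean document; each statement's English description precedes it below -/
import Mathlib

section
/- Let α be a finite type and let p, q be probability vectors on α with supp p ⊆ supp q. Let k ≥ 0 with KL(p‖q) ≤ k, and let ε ≥ 0, δ ≥ 0 be such that, writing Y y = log(p y / q y) and μ = KL(p‖q), we have ∑_{y : Y y ∉ [(1−ε)μ, (1+ε)μ]} p y ≤ δ. Then for every subset E ⊆ α, ∑_{y ∈ E} p y ≤ exp((1+ε)k) * (∑_{y ∈ E} q y) + δ. -/
open Real Finset
open scoped Classical

theorem le_exp_mul_of_log_div_le {a b t : ℝ} (ha : 0 ≤ a) (hb : 0 ≤ b) (hab : b = 0 → a = 0)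
    (h : log (a / b) ≤ t) : a ≤ exp t * b := by
  rcases ha.eq_or_lt with rfl | ha
  · positivity
  · have hb : 0 < b := hb.lt_of_ne fun h0 => ha.ne' (hab h0.symm)
    rw [← div_le_iff₀ hb]
    exact (log_le_iff_le_exp (div_pos ha hb)).mp h

theorem knaf_event_bound {α : Type*} [Fintype α]
    (p q : α → ℝ) (k ε δ : ℝ)
    (hp0 : ∀ y, 0 ≤ p y) (hp1 : ∑ y, p y = 1)
    (hq0 : ∀ y, 0 ≤ q y) (hq1 : ∑ y, q y = 1)
    (hsupp : ∀ y, q y = 0 → p y = 0)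
    (hk : 0 ≤ k)
    (hKL : ∑ y, p y * log (p y / q y) ≤ k)
    (hε : 0 ≤ ε) (hδ : 0 ≤ δ)
    (hconc : ∑ y ∈ Finset.univ.filter
        (fun y => ¬((1 - ε) * (∑ x, p x * log (p x / q x)) ≤ log (p y / q y) ∧
                    log (p y / q y) ≤ (1 + ε) * (∑ x, p x * log (p x / q x)))), p y ≤ δ) :
    ∀ E : Finset α, ∑ y ∈ E, p y ≤ exp ((1 + ε) * k) * (∑ y ∈ E, q y) + δ := by
  intro E
  set μ := ∑ x, p x * log (p x / q x)
  set B := Finset.univ.filter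
    (fun y => ¬((1 - ε) * μ ≤ log (p y / q y) ∧ log (p y / q y) ≤ (1 + ε) * μ))
  have hμ : (1 + ε) * μ ≤ (1 + ε) * k := by gcongr
  have hbad : ∑ y ∈ E with y ∈ B, p y ≤ δ :=
    (sum_le_sum_of_subset_of_nonneg (fun y hy => (mem_filter.mp hy).2)
      fun y _ _ => hp0 y).trans hconc
  have hgood : ∑ y ∈ E with y ∉ B, p y ≤ exp ((1 + ε) * k) * ∑ y ∈ E, q y := by
    calc ∑ y ∈ E with y ∉ B, p y ≤ ∑ y ∈ E with y ∉ B, exp ((1 + ε) * k) * q y := by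
          refine sum_le_sum fun y hy => ?_
          have hy : (1 - ε) * μ ≤ log (p y / q y) ∧ log (p y / q y) ≤ (1 + ε) * μ := by
            by_contra hc
            exact (mem_filter.mp hy).2 (mem_filter.mpr ⟨mem_univ y, hc⟩)
          exact le_exp_mul_of_log_div_le (hp0 y) (hq0 y) (hsupp y) (hy.2.trans hμ)
      _ ≤ ∑ y ∈ E, exp ((1 + ε) * k) * q y :=
          sum_le_sum_of_subset_of_nonneg (filter_subset _ _)
            fun y _ _ => mul_nonneg (exp_pos _).le (hq0 y)
      _ = exp ((1 + ε) * k) * ∑ y ∈ E, q y := (mul_sum _ _ _).symm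
  rw [← sum_filter_add_sum_filter_not E (· ∈ B)]
  linarith
end

section
/- Let α be a finite type and let l, s be probability vectors on α. Set Z = ∑ y, sqrt(l y * s y) and assume Z > 0. Define p y = sqrt(l y * s y) / Z. Then p is a probability vector with supp p ⊆ supp l and supp p ⊆ supp s, and KL(p‖l) + KL(p‖s) = −2 * log Z. -/
open Real Finset

theorem log_sqrt_mul_div_div_add_log_sqrt_mul_div_div {a b z : ℝ} (ha : 0 < a) (hb : 0 < b)
    (hz : 0 < z) :
    Real.log (Real.sqrt (a * b) / z / a) + Real.log (Real.sqrt (a * b) / z / b) =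
      -2 * Real.log z := by
  have hab : 0 < Real.sqrt (a * b) := Real.sqrt_pos.mpr (mul_pos ha hb)
  rw [Real.log_div (div_pos hab hz).ne' ha.ne', Real.log_div (div_pos hab hz).ne' hb.ne',
    Real.log_div hab.ne' hz.ne', Real.log_sqrt (mul_pos ha hb).le, Real.log_mul ha.ne' hb.ne']
  ring

theorem geom_mean_ensemble_prob_supp_KL_sum {α : Type*} [Fintype α]
    (l s : α → ℝ)
    (hl0 : ∀ y, 0 ≤ l y) (hl1 : ∑ y, l y = 1)
    (hs0 : ∀ y, 0 ≤ s y) (hs1 : ∑ y, s y = 1)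
    (hZ : 0 < ∑ y, Real.sqrt (l y * s y))
    (p : α → ℝ)
    (hp : ∀ y, p y = Real.sqrt (l y * s y) / (∑ x, Real.sqrt (l x * s x))) :
    (∀ y, 0 ≤ p y) ∧ (∑ y, p y = 1) ∧
    (∀ y, l y = 0 → p y = 0) ∧ (∀ y, s y = 0 → p y = 0) ∧
    (∑ y, p y * log (p y / l y)) + (∑ y, p y * log (p y / s y)) =
      -2 * log (∑ x, Real.sqrt (l x * s x)) := by
  have hsum : ∑ y, p y = 1 := by
    simp_rw [hp]
    rw [← Finset.sum_div, div_self hZ.ne']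
  have hpl : ∀ y, l y = 0 → p y = 0 := fun y hy => by simp [hp, hy]
  have hps : ∀ y, s y = 0 → p y = 0 := fun y hy => by simp [hp, hy]
  refine ⟨fun y => ?_, hsum, hpl, hps, ?_⟩
  · rw [hp]
    exact div_nonneg (Real.sqrt_nonneg _) hZ.le
  rw [← Finset.sum_add_distrib, ← one_mul (-2 * _), ← hsum, Finset.sum_mul]
  refine Finset.sum_congr rfl fun y _ => ?_
  by_cases hy : p y = 0
  · simp [hy]
  have hly : 0 < l y := (hl0 y).lt_of_ne' (mt (hpl y) hy)
  have hsy : 0 < s y := (hs0 y).lt_of_ne' (mt (hps y) hy)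
  rw [← mul_add, ← log_sqrt_mul_div_div_add_log_sqrt_mul_div_div hly hsy hZ, ← hp]
end

section
/- Let α be a finite type and let l, s be probability vectors on α. Set Z = ∑ y, sqrt(l y * s y) and assume Z > 0. Define p y = sqrt(l y * s y) / Z. Then max(KL(p‖l), KL(p‖s)) ≤ −2 * log Z. -/
open Real Finset

/-- Gibbs' inequality on a finite type. -/
theorem sum_mul_log_div_nonneg {α : Type*} [Fintype α] {p q : α → ℝ}
    (hp0 : ∀ y, 0 ≤ p y) (hq0 : ∀ y, 0 ≤ q y) (hpq : ∀ y, q y = 0 → p y = 0)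
    (hsum : ∑ y, q y ≤ ∑ y, p y) :
    0 ≤ ∑ y, p y * log (p y / q y) := by
  have key : ∀ y, p y - q y ≤ p y * log (p y / q y) := by
    intro y
    rcases (hp0 y).eq_or_lt with h | h
    · simpa [← h] using hq0 y
    · have hq : 0 < q y := (hq0 y).lt_of_ne fun h' => h.ne' (hpq y h'.symm)
      calc p y - q y = p y * (1 - (p y / q y)⁻¹) := by field_simp
        _ ≤ p y * log (p y / q y) :=
          mul_le_mul_of_nonneg_left (one_sub_inv_le_log_of_pos (div_pos h hq)) h.le
  calc 0 ≤ ∑ y, (p y - q y) := by rw [sum_sub_distrib]; linarith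
    _ ≤ _ := sum_le_sum fun y _ => key y

theorem log_sqrt_mul_div_add_log_sqrt_mul_div {a b z : ℝ} (ha : 0 < a) (hb : 0 < b)
    (hz : 0 < z) :
    log (√(a * b) / z / a) + log (√(a * b) / z / b) = -2 * log z := by
  have hab : 0 < √(a * b) := sqrt_pos.2 (mul_pos ha hb)
  rw [log_div (div_pos hab hz).ne' ha.ne', log_div (div_pos hab hz).ne' hb.ne',
    log_div hab.ne' hz.ne', log_sqrt (mul_pos ha hb).le, log_mul ha.ne' hb.ne']
  ring

theorem geom_mean_ensemble_max_KL_bound {α : Type*} [Fintype α]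
    (l s : α → ℝ)
    (hl0 : ∀ y, 0 ≤ l y) (hl1 : ∑ y, l y = 1)
    (hs0 : ∀ y, 0 ≤ s y) (hs1 : ∑ y, s y = 1)
    (hZ : 0 < ∑ y, Real.sqrt (l y * s y))
    (p : α → ℝ)
    (hp : ∀ y, p y = Real.sqrt (l y * s y) / (∑ x, Real.sqrt (l x * s x))) :
    max (∑ y, p y * log (p y / l y)) (∑ y, p y * log (p y / s y)) ≤
      -2 * log (∑ x, Real.sqrt (l x * s x)) := by
  set Z := ∑ x, Real.sqrt (l x * s x) with hZdef
  have hp0 : ∀ y, 0 ≤ p y := fun y => by rw [hp]; positivity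
  have hp1 : ∑ y, p y = 1 := by
    simp_rw [hp]
    rw [← sum_div, ← hZdef, div_self hZ.ne']
  have hpl : ∀ y, l y = 0 → p y = 0 := fun y h => by simp [hp, h]
  have hps : ∀ y, s y = 0 → p y = 0 := fun y h => by simp [hp, h]
  have hKLl := sum_mul_log_div_nonneg hp0 hl0 hpl (hl1.trans hp1.symm).le
  have hKLs := sum_mul_log_div_nonneg hp0 hs0 hps (hs1.trans hp1.symm).le
  have hadd : ∑ y, p y * log (p y / l y) + ∑ y, p y * log (p y / s y) = -2 * log Z := by
    rw [← sum_add_distrib, ← one_mul (-2 * log Z), ← hp1, sum_mul]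
    refine sum_congr rfl fun y _ => ?_
    by_cases h : p y = 0
    · simp [h]
    · have hl : 0 < l y := (hl0 y).lt_of_ne' (mt (hpl y) h)
      have hs : 0 < s y := (hs0 y).lt_of_ne' (mt (hps y) h)
      rw [← mul_add, hp y, log_sqrt_mul_div_add_log_sqrt_mul_div hl hs hZ]
  exact max_le (by linarith) (by linarith)
end

section
/- Let α be a finite type and let z_l, z_s : α → ℝ. Then for every y, softmax((z_l + z_s)/2) y = sqrt(softmax(z_l) y * softmax(z_s) y) / (∑ y', sqrt(softmax(z_l) y' * softmax(z_s) y')); that is, the geometric-mean ensemble of the softmax distributions of z_l and z_s equals the softmax of the averaged logits. -/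
open Real Finset

noncomputable def softmax {α : Type*} [Fintype α] (z : α → ℝ) (y : α) : ℝ :=
  Real.exp (z y) / ∑ y', Real.exp (z y')

theorem softmax_denominator_pos {α : Type*} [Fintype α] [Nonempty α] (z : α → ℝ) :
    0 < ∑ y, Real.exp (z y) :=
  Finset.sum_pos (fun _ _ => Real.exp_pos _) Finset.univ_nonempty

theorem sqrt_softmax_mul_softmax {α : Type*} [Fintype α] (zl zs : α → ℝ) (y : α) :
    Real.sqrt (softmax zl y * softmax zs y) =
      Real.exp ((zl y + zs y) / 2) /
        Real.sqrt ((∑ y', Real.exp (zl y')) * ∑ y', Real.exp (zs y')) := by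
  rw [softmax, softmax, div_mul_div_comm, ← Real.exp_add, Real.sqrt_div (Real.exp_pos _).le,
    Real.exp_half]

theorem softmax_avg_logits_eq_geom_mean_ensemble {α : Type*} [Fintype α]
    (zl zs : α → ℝ) :
    ∀ y, softmax (fun x => (zl x + zs x) / 2) y =
      Real.sqrt (softmax zl y * softmax zs y) /
        (∑ y', Real.sqrt (softmax zl y' * softmax zs y')) := by
  intro y
  have : Nonempty α := ⟨y⟩
  have hZ : Real.sqrt ((∑ y', Real.exp (zl y')) * ∑ y', Real.exp (zs y')) ≠ 0 :=
    (Real.sqrt_pos.mpr (mul_pos (softmax_denominator_pos zl) (softmax_denominator_pos zs))).ne'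
  simp_rw [sqrt_softmax_mul_softmax]
  rw [← Finset.sum_div, div_div_div_cancel_right₀ hZ, softmax]
end

section
/- Let α be a finite type and let l, s be probability vectors on α. Set Z = ∑ y, sqrt(l y * s y), assume Z > 0, and define p y = sqrt(l y * s y) / Z. Let ε ≥ 0 and δ ≥ 0 be such that, writing Y y = log(p y / s y) (for y with p y > 0) and μ = KL(p‖s), we have ∑_{y : p y > 0 and Y y ∉ [(1−ε)μ, (1+ε)μ]} p y ≤ δ. Then for every subset E ⊆ α, ∑_{y ∈ E} p y ≤ Z^(−2(1+ε)) * (∑_{y ∈ E} s y) + δ. -/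
open Real Finset
open scoped Classical

/-- Pointwise form of `KL(p‖s) + KL(p‖l) = -2 log Z`, with `KL(p‖l)` bounded below termwise. -/
lemma mul_log_div_le_of_geom_mean {l s p Z : ℝ} (hl : 0 ≤ l) (hs : 0 ≤ s) (hZ : 0 < Z)
    (hp : p = Real.sqrt (l * s) / Z) :
    p * log (p / s) ≤ p * (-2 * log Z) + (l - p) := by
  have hp0 : 0 ≤ p := by rw [hp]; positivity
  rcases hp0.eq_or_lt with h | hpos
  · simp [← h, hl]
  have hls : l * s ≠ 0 := by
    intro h
    simp [hp, h] at hpos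
  have hl' : 0 < l := hl.lt_of_ne' (left_ne_zero_of_mul hls)
  have hs' : 0 < s := hs.lt_of_ne' (right_ne_zero_of_mul hls)
  have hlogp : log p = (log l + log s) / 2 - log Z := by
    rw [hp, log_div (by positivity) hZ.ne', log_sqrt (by positivity), log_mul hl'.ne' hs'.ne']
  have hlog : log (l / p) ≤ l / p - 1 := log_le_sub_one_of_pos (by positivity)
  have hmul : p * log (l / p) ≤ l - p := by
    calc p * log (l / p) ≤ p * (l / p - 1) := by gcongr
      _ = l - p := by field_simp
  have hsplit : log (p / s) = -2 * log Z + log (l / p) := by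
    rw [log_div hpos.ne' hs'.ne', log_div hl'.ne' hpos.ne']
    linarith
  rw [hsplit, mul_add]
  linarith

/-- If `p ≤ c * s` off an event `P` of `p`-mass at most `δ`, then `p(E) ≤ c * s(E) + δ`. -/
lemma sum_le_mul_sum_add_of_sum_filter_le {α : Type*} [Fintype α] (P : α → Prop)
    [DecidablePred P] {p s : α → ℝ} {c δ : ℝ} (hp : ∀ y, 0 ≤ p y) (hs : ∀ y, 0 ≤ s y)
    (hc : 0 ≤ c) (hP : ∑ y with P y, p y ≤ δ) (h : ∀ y, ¬P y → p y ≤ c * s y) (E : Finset α) :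
    ∑ y ∈ E, p y ≤ c * (∑ y ∈ E, s y) + δ := by
  rw [← Finset.sum_filter_not_add_sum_filter E P, Finset.mul_sum]
  refine add_le_add ?_ (le_trans ?_ hP)
  · calc ∑ y ∈ E with ¬P y, p y ≤ ∑ y ∈ E with ¬P y, c * s y :=
          Finset.sum_le_sum fun y hy => h y (Finset.mem_filter.mp hy).2
      _ ≤ ∑ y ∈ E, c * s y :=
          Finset.sum_le_sum_of_subset_of_nonneg (Finset.filter_subset _ _) fun y _ _ =>
            mul_nonneg hc (hs y)
  · exact Finset.sum_le_sum_of_subset_of_nonneg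
      (Finset.filter_subset_filter _ (Finset.subset_univ E)) fun y _ _ => hp y

theorem geom_mean_ensemble_event_bound {α : Type*} [Fintype α]
    (l s : α → ℝ) (ε δ : ℝ)
    (hl0 : ∀ y, 0 ≤ l y) (hl1 : ∑ y, l y = 1)
    (hs0 : ∀ y, 0 ≤ s y) (hs1 : ∑ y, s y = 1)
    (hZ : 0 < ∑ y, Real.sqrt (l y * s y))
    (p : α → ℝ)
    (hp : ∀ y, p y = Real.sqrt (l y * s y) / (∑ x, Real.sqrt (l x * s x)))
    (hε : 0 ≤ ε) (hδ : 0 ≤ δ)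
    (hconc : ∑ y ∈ Finset.univ.filter
        (fun y => 0 < p y ∧
          ¬((1 - ε) * (∑ x, p x * log (p x / s x)) ≤ log (p y / s y) ∧
            log (p y / s y) ≤ (1 + ε) * (∑ x, p x * log (p x / s x)))), p y ≤ δ) :
    ∀ E : Finset α,
      ∑ y ∈ E, p y ≤
        (∑ x, Real.sqrt (l x * s x)) ^ (-(2 * (1 + ε))) * (∑ y ∈ E, s y) + δ := by
  intro E
  set Z := ∑ x, Real.sqrt (l x * s x) with hZdef
  set μ := ∑ x, p x * log (p x / s x)
  have hp0 : ∀ y, 0 ≤ p y := fun y => by rw [hp]; positivity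
  have hp1 : ∑ y, p y = 1 := by
    simp_rw [hp]
    rw [← Finset.sum_div, ← hZdef, div_self hZ.ne']
  have hμ : μ ≤ -2 * log Z := by
    calc μ ≤ ∑ y, (p y * (-2 * log Z) + (l y - p y)) :=
          Finset.sum_le_sum fun y _ => mul_log_div_le_of_geom_mean (hl0 y) (hs0 y) hZ (hp y)
      _ = -2 * log Z := by
          rw [Finset.sum_add_distrib, ← Finset.sum_mul, Finset.sum_sub_distrib, hp1, hl1]
          ring
  refine sum_le_mul_sum_add_of_sum_filter_le _ hp0 hs0 (rpow_nonneg hZ.le _) hconc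
    (fun y hy => ?_) E
  rcases (hp0 y).eq_or_lt with h | hpos
  · rw [← h]
    exact mul_nonneg (rpow_nonneg hZ.le _) (hs0 y)
  have hs' : 0 < s y := (hs0 y).lt_of_ne' fun h => by simp [hp, h] at hpos
  have hlog : log (p y / s y) ≤ (1 + ε) * μ := by
    by_contra h
    exact hy ⟨hpos, fun h' => h h'.2⟩
  rw [← div_le_iff₀ hs', rpow_def_of_pos hZ, ← log_le_iff_le_exp (by positivity)]
  calc log (p y / s y) ≤ (1 + ε) * μ := hlog
    _ ≤ (1 + ε) * (-2 * log Z) := by gcongr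
    _ = log Z * -(2 * (1 + ε)) := by ring
end

section
/- Let α be a finite type and let l, s be probability vectors on α with squared Hellinger distance H² = (1/2) * ∑ y, (sqrt(l y) − sqrt(s y))^2 satisfying H² < 1. Define p y = sqrt(l y * s y) / Z with Z = ∑ y, sqrt(l y * s y). Then Z = 1 − H² > 0 and max(KL(p‖l), KL(p‖s)) ≤ −2 * log(1 − H²). -/
open Real Finset

theorem sum_sqrt_mul_eq_one_sub_hellinger {α : Type*} [Fintype α] (l s : α → ℝ)
    (hl0 : ∀ y, 0 ≤ l y) (hl1 : ∑ y, l y = 1)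
    (hs0 : ∀ y, 0 ≤ s y) (hs1 : ∑ y, s y = 1) :
    ∑ x, Real.sqrt (l x * s x) =
      1 - (1 / 2) * ∑ y, (Real.sqrt (l y) - Real.sqrt (s y)) ^ 2 := by
  have h : ∀ y, (Real.sqrt (l y) - Real.sqrt (s y)) ^ 2 =
      l y + s y - 2 * Real.sqrt (l y * s y) := fun y => by
    rw [Real.sqrt_mul (hl0 y), sub_sq, Real.sq_sqrt (hl0 y), Real.sq_sqrt (hs0 y)]
    ring
  simp only [h, Finset.sum_sub_distrib, Finset.sum_add_distrib, ← Finset.mul_sum, hl1, hs1]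
  ring

/-- The pointwise form of the divergence bound, from `log x ≤ x - 1`. -/
theorem mul_log_div_le_of_sq_mul_sq_eq {p l s Z : ℝ} (hp : 0 ≤ p) (hl : 0 ≤ l) (hs : 0 ≤ s)
    (hZ : 0 < Z) (h : p ^ 2 * Z ^ 2 = l * s) :
    p * log (p / l) ≤ s - p - 2 * log Z * p := by
  rcases hp.eq_or_lt with rfl | hp
  · simpa using hs
  have hl : 0 < l := hl.lt_of_ne fun h0 => by
    have : 0 < p ^ 2 * Z ^ 2 := by positivity
    simp [h, ← h0] at this
  have hlog : log (p / l * Z ^ 2) = log (p / l) + 2 * log Z := by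
    rw [Real.log_mul (by positivity) (by positivity), Real.log_pow]
    norm_num
  have hle := mul_le_mul_of_nonneg_left
    (Real.log_le_sub_one_of_pos (show 0 < p / l * Z ^ 2 by positivity)) hp.le
  have hs' : p * (p / l * Z ^ 2) = s := by
    field_simp
    linarith
  rw [hlog, mul_sub, hs'] at hle
  linarith

theorem sum_mul_log_div_le_of_sq_mul_sq_eq {α : Type*} [Fintype α] {p l s : α → ℝ} {Z : ℝ}
    (hp0 : ∀ y, 0 ≤ p y) (hp1 : ∑ y, p y = 1) (hl0 : ∀ y, 0 ≤ l y)
    (hs0 : ∀ y, 0 ≤ s y) (hs1 : ∑ y, s y = 1) (hZ : 0 < Z)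
    (h : ∀ y, p y ^ 2 * Z ^ 2 = l y * s y) :
    ∑ y, p y * log (p y / l y) ≤ -2 * log Z := by
  refine (Finset.sum_le_sum fun y _ =>
    mul_log_div_le_of_sq_mul_sq_eq (hp0 y) (hl0 y) (hs0 y) hZ (h y)).trans_eq ?_
  rw [Finset.sum_sub_distrib, Finset.sum_sub_distrib, ← Finset.mul_sum, hp1, hs1]
  ring

theorem geom_mean_ensemble_hellinger_bound {α : Type*} [Fintype α]
    (l s : α → ℝ)
    (hl0 : ∀ y, 0 ≤ l y) (hl1 : ∑ y, l y = 1)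
    (hs0 : ∀ y, 0 ≤ s y) (hs1 : ∑ y, s y = 1)
    (hH : (1 / 2) * ∑ y, (Real.sqrt (l y) - Real.sqrt (s y)) ^ 2 < 1)
    (p : α → ℝ)
    (hp : ∀ y, p y = Real.sqrt (l y * s y) / (∑ x, Real.sqrt (l x * s x))) :
    (∑ x, Real.sqrt (l x * s x)) =
        1 - (1 / 2) * ∑ y, (Real.sqrt (l y) - Real.sqrt (s y)) ^ 2 ∧
    0 < ∑ x, Real.sqrt (l x * s x) ∧
    max (∑ y, p y * log (p y / l y)) (∑ y, p y * log (p y / s y)) ≤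
      -2 * log (1 - (1 / 2) * ∑ y, (Real.sqrt (l y) - Real.sqrt (s y)) ^ 2) := by
  have hZ := sum_sqrt_mul_eq_one_sub_hellinger l s hl0 hl1 hs0 hs1
  have hpos : 0 < ∑ x, Real.sqrt (l x * s x) := by linarith
  refine ⟨hZ, hpos, ?_⟩
  rw [← hZ]
  have hp0 : ∀ y, 0 ≤ p y := fun y => by
    rw [hp]
    positivity
  have hp1 : ∑ y, p y = 1 := by
    simp only [hp, ← Finset.sum_div]
    exact div_self hpos.ne'
  have h : ∀ y, p y ^ 2 * (∑ x, Real.sqrt (l x * s x)) ^ 2 = l y * s y := fun y => by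
    rw [hp, ← mul_pow, div_mul_cancel₀ _ hpos.ne', Real.sq_sqrt (mul_nonneg (hl0 y) (hs0 y))]
  exact max_le (sum_mul_log_div_le_of_sq_mul_sq_eq hp0 hp1 hl0 hs0 hs1 hpos h)
    (sum_mul_log_div_le_of_sq_mul_sq_eq hp0 hp1 hs0 hl0 hl1 hpos
      fun y => (h y).trans (mul_comm _ _))
end
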